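/- Let (G,+) be a finite Abelian group with |G| = q. If W : G → 𝒴 is a generalized q-symmetric channel, then W⁻ : G → 𝒴² is a generalized q-symmetric channel. -/

import Mathlib

open scoped Classical

noncomputable section

universe u v

/-- A (discrete memoryless) channel with input alphabet `X` and finite output alphabet `Y`:
nonnegative entries and each row sums to `1`. -/
def IsChannel {X : Type*} {Y : Type*} [Fintype Y] (W : X → Y → ℝ) : Prop :=
  (∀ x y, 0 ≤ W x y) ∧ ∀ x, ∑ y, W x y = 1

/-- The symmetric capacity of a channel: the mutual information between a uniformly
distributed input and the corresponding output (terms with `W x y = 0` vanish). -/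
def capacity {X : Type*} {Y : Type*} [Fintype X] [Fintype Y] (W : X → Y → ℝ) : ℝ :=
  ∑ y : Y, ∑ x : X, (1 / (Fintype.card X : ℝ)) * W x y *
    Real.log (W x y / ((1 / (Fintype.card X : ℝ)) * ∑ x' : X, W x' y))

/-- The quotient channel `W[H] : G ⧸ H → Y`, `W[H](y|A) = (1/|H|) ∑_{x ∈ A} W(y|x)`. -/
def quotientChannel {G : Type*} [AddCommGroup G] [Fintype G] (H : AddSubgroup G)
    {Y : Type*} (W : G → Y → ℝ) : G ⧸ H → Y → ℝ :=
  fun A y => (1 / (Nat.card H : ℝ)) * ∑ x : G, if (x : G ⧸ H) = A then W x y else 0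

/-- `W` is `δ`-determined by the subgroup `H`:
`|I(W) − log|G/H|| < δ` and `|I(W[H]) − log|G/H|| < δ`. -/
def DeterminedBy {G : Type*} [AddCommGroup G] [Fintype G] {Y : Type*} [Fintype Y]
    (W : G → Y → ℝ) (H : AddSubgroup G) (δ : ℝ) : Prop :=
  |capacity W - Real.log (Nat.card (G ⧸ H))| < δ ∧
  |capacity (quotientChannel H W) - Real.log (Nat.card (G ⧸ H))| < δ

/-- The "minus" Arıkan transform `W⁻(y₁,y₂|u₁) = (1/q) ∑_{u₂} W(y₁|u₁+u₂) W(y₂|u₂)`. -/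
def minusChannel {G : Type*} [AddCommGroup G] [Fintype G] {Y : Type*}
    (W : G → Y → ℝ) : G → Y × Y → ℝ :=
  fun u₁ y => (1 / (Fintype.card G : ℝ)) * ∑ u₂ : G, W (u₁ + u₂) y.1 * W u₂ y.2

/-- The "plus" Arıkan transform `W⁺(y₁,y₂,u₁|u₂) = (1/q) W(y₁|u₁+u₂) W(y₂|u₂)`;
the output `(y₁, y₂, u₁)` is encoded as `((y₁, y₂), u₁)`. -/
def plusChannel {G : Type*} [AddCommGroup G] [Fintype G] {Y : Type*}
    (W : G → Y → ℝ) : G → (Y × Y) × G → ℝ :=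
  fun u₂ z => (1 / (Fintype.card G : ℝ)) * W (z.2 + u₂) z.1.1 * W u₂ z.1.2

/-- `W` is degraded from `W'`: `W` is obtained from `W'` by composing with a channel `V`. -/
def DegradedFrom {X : Type*} {Y Y' : Type*} [Fintype Y] [Fintype Y'] (W : X → Y → ℝ)
    (W' : X → Y' → ℝ) : Prop :=
  ∃ V : Y' → Y → ℝ, IsChannel V ∧ ∀ x y, W x y = ∑ y' : Y', W' x y' * V y' y

/-- Channel equivalence: mutual degradation. -/
def EquivalentChannels {X : Type*} {Y Y' : Type*} [Fintype Y] [Fintype Y'] (W : X → Y → ℝ)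
    (W' : X → Y' → ℝ) : Prop :=
  DegradedFrom W W' ∧ DegradedFrom W' W

/-- The erasure channel of input alphabet `A` and parameter `ε`; the output alphabet is
`A ∪ {e}`, modelled as `Option A` with `none` as the erasure symbol `e`. For `A = G` this is
the `q`-ary erasure channel `qEC(ε)`. -/
def erasureChannel (A : Type*) (ε : ℝ) : A → Option A → ℝ :=
  fun x y => match y with
    | some z => if z = x then 1 - ε else 0
    | none => ε

/-- `W : G → Y → ℝ` is a generalized `q`-symmetric channel. -/
def IsGeneralizedSymmetric {G : Type u} [Fintype G] {Y : Type v} [Fintype Y]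
    (W : G → Y → ℝ) : Prop :=
  ∃ (Z : Type v) (_ : Fintype Z) (π : G × Z ≃ Y) (p : Z → ℝ) (ε : Z → ℝ),
    (∀ z, 0 ≤ p z) ∧ (∑ z, p z = 1) ∧
    (∀ z, 0 ≤ ε z) ∧ (∀ z, ε z ≤ 1 / ((Fintype.card G : ℝ) - 1)) ∧
    ∀ x x' z, W x (π (x', z)) =
      if x' = x then p z * (1 - ((Fintype.card G : ℝ) - 1) * ε z) else p z * ε z

/-- `W` is automorphic-symmetric with respect to `(G,+)`: for every automorphism `f` of `G`
there is a bijection `π_f` of the output alphabet with `W(π_f(y)|f(x)) = W(y|x)`. -/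
def IsAutSymmetric {G : Type*} [AddCommGroup G] {Y : Type*} (W : G → Y → ℝ) : Prop :=
  ∀ f : G ≃+ G, ∃ π : Y ≃ Y, ∀ x y, W (f x) (π y) = W x y

/-- A channel with input alphabet `G`, packaged with its (finite) output alphabet. -/
structure Channel (G : Type u) where
  Out : Type u
  [fin : Fintype Out]
  prob : G → Out → ℝ

attribute [instance] Channel.fin

def Channel.minus {G : Type u} [AddCommGroup G] [Fintype G] (C : Channel G) : Channel G :=
  ⟨C.Out × C.Out, minusChannel C.prob⟩

def Channel.plus {G : Type u} [AddCommGroup G] [Fintype G] (C : Channel G) : Channel G :=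
  ⟨(C.Out × C.Out) × G, plusChannel C.prob⟩

/-- `C.polar s` is the synthetic channel `W^s`, where `false` encodes `-`, `true` encodes `+`,
and the head of the list is the first transform applied. -/
def Channel.polar {G : Type u} [AddCommGroup G] [Fintype G] (C : Channel G) :
    List Bool → Channel G
  | [] => C
  | b :: s => (cond b C.plus C.minus).polar s

/-- `C` `𝓗`-polarizes: for every `δ > 0`, the fraction of `s ∈ {−,+}ⁿ` such that `W^s` is
`δ`-determined by some subgroup in `𝓗` tends to `1` as `n → ∞`. Taking `𝓗` to be the set of
all subgroups gives the background (multilevel) polarization property. -/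
def Polarizes {G : Type u} [AddCommGroup G] [Fintype G] (C : Channel G)
    (𝓗 : Set (AddSubgroup G)) : Prop :=
  ∀ δ > (0 : ℝ), Filter.Tendsto
    (fun n : ℕ => ((Finset.univ.filter (fun s : Fin n → Bool =>
        ∃ H ∈ 𝓗, DeterminedBy (C.polar (List.ofFn s)).prob H δ)).card : ℝ) / 2 ^ n)
    Filter.atTop (nhds 1)

/-- The convolution of two functions that are constant off a single point, `a` for the first and
`b` for the second, is constant off `a - b`. -/
lemma sum_ite_mul_ite_add {G : Type*} [AddCommGroup G] [Fintype G] (a b x : G) (c d e f : ℝ) :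
    ∑ u : G, (if a + b = x + u then c + d else c) * (if b = u then e + f else e) =
      Fintype.card G * (c * e) + c * f + d * e + if a = x then d * f else 0 := by
  have h : ∀ u : G, (if a + b = x + u then c + d else c) * (if b = u then e + f else e) =
      c * e + (if b = u then c * f else 0) + (if a + b - x = u then d * e else 0) +
        if b = u then (if a = x then d * f else 0) else 0 := by
    intro u
    have h1 : a + b = x + u ↔ a + b - x = u := by rw [sub_eq_iff_eq_add, add_comm u x]
    rw [← h1]
    by_cases hb : b = u
    · subst hb
      by_cases ha : a = x <;> simp [ha] <;> ring
    · by_cases ha : a + b = x + u <;> simp only [ha, hb, if_true, if_false] <;> ring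
  simp_rw [h, Finset.sum_add_distrib]
  simp

/-- If two error parameters lie in `[0, 1 / (q - 1)]`, then so does their composition. -/
lemma symmetric_error_comp_mem {q s t : ℝ} (hq : q = 1 ∨ 2 ≤ q) (hs : 0 ≤ s)
    (hs' : s ≤ 1 / (q - 1)) (ht : 0 ≤ t) (ht' : t ≤ 1 / (q - 1)) :
    0 ≤ s + t - q * (s * t) ∧ s + t - q * (s * t) ≤ 1 / (q - 1) := by
  rcases hq with rfl | hq
  · norm_num at hs' ht'
    obtain rfl : s = 0 := le_antisymm hs' hs
    obtain rfl : t = 0 := le_antisymm ht' ht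
    norm_num
  · have hq0 : 0 < q - 1 := by linarith
    rw [le_div_iff₀ hq0] at hs' ht' ⊢
    have hs1 : s ≤ 1 := by nlinarith
    constructor
    · nlinarith [mul_nonneg hs (sub_nonneg.2 ht'), mul_nonneg ht (sub_nonneg.2 hs1)]
    · nlinarith [mul_nonneg (sub_nonneg.2 hs') (sub_nonneg.2 ht'), mul_nonneg hq0.le
        (mul_nonneg hs ht)]

/-- Reparametrizes pairs of outputs by shifting the first input label by that of the second
output. -/
def minusOutputEquiv {G : Type*} [AddCommGroup G] {Z Y : Type*} (π : G × Z ≃ Y) :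
    G × (Z × Y) ≃ Y × Y where
  toFun w := (π (w.1 + (π.symm w.2.2).1, w.2.1), w.2.2)
  invFun y := ((π.symm y.1).1 - (π.symm y.2).1, (π.symm y.1).2, y.2)
  left_inv w := by simp
  right_inv y := by simp

/-- if `W` is a generalized `q`-symmetric channel, then so is `W⁻`. -/
theorem stmt_16 {G : Type u} [AddCommGroup G] [Fintype G] {Y : Type v} [Fintype Y]
    (W : G → Y → ℝ) (hW : IsChannel W) (hsym : IsGeneralizedSymmetric W) :
    IsGeneralizedSymmetric (minusChannel W) := by
  obtain ⟨Z, _, π, p, ε, hp, hp1, hε, hε', hWπ⟩ := hsym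
  have hq0 : (Fintype.card G : ℝ) ≠ 0 := Nat.cast_ne_zero.2 Fintype.card_ne_zero
  have hq : (Fintype.card G : ℝ) = 1 ∨ 2 ≤ (Fintype.card G : ℝ) := by
    have h : 0 < Fintype.card G := Fintype.card_pos
    rcases Nat.eq_or_lt_of_le (Nat.succ_le_of_lt h) with h | h
    · exact Or.inl (by exact_mod_cast h.symm)
    · exact Or.inr (by exact_mod_cast h)
  have hε₂ (z z' : Z) :=
    symmetric_error_comp_mem hq (hε z) (hε' z) (hε z') (hε' z')
  refine ⟨Z × Y, inferInstance, minusOutputEquiv π,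
    fun w => p w.1 * (p (π.symm w.2).2 / Fintype.card G),
    fun w => ε w.1 + ε (π.symm w.2).2 - Fintype.card G * (ε w.1 * ε (π.symm w.2).2),
    fun w => by have := hp w.1; have := hp (π.symm w.2).2; positivity, ?_,
    fun w => (hε₂ _ _).1, fun w => (hε₂ _ _).2, ?_⟩
  · have hY : ∑ y : Y, p (π.symm y).2 / Fintype.card G = 1 := by
      rw [← π.sum_comp, Fintype.sum_prod_type]
      simp [← Finset.sum_div, hp1, hq0]
    rw [Fintype.sum_prod_type]
    simp_rw [← Finset.mul_sum, hY, mul_one, hp1]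
  · rintro x x' ⟨z, y⟩
    obtain ⟨⟨b, z'⟩, rfl⟩ := π.surjective y
    have hform (u v : G) (t : Z) : W u (π (v, t)) =
        p t * if v = u then ε t + (1 - Fintype.card G * ε t) else ε t := by
      rw [hWπ]
      split_ifs <;> ring
    have hsum := sum_ite_mul_ite_add x' b x (ε z) (1 - Fintype.card G * ε z)
      (ε z') (1 - Fintype.card G * ε z')
    simp only [minusChannel, minusOutputEquiv, Equiv.coe_fn_mk, Equiv.symm_apply_apply, hform,
      mul_mul_mul_comm (p z), ← Finset.mul_sum, hsum]
    split_ifs <;> field_simp <;> ring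

end
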